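/- Let 1 ≤ n ≤ p. The module of covariants k[V_2]^G(V_n) is a free module over the invariant ring k[V_2]^G, generated freely by the n covariants Θ(x_1^k) = Σ_{i=1}^{n} Δ^{i−1}(x_1^k) ⊗ w_i for k = 0, 1, …, n−1 (where Θ(x_1^0) = Θ(1) = 1 ⊗ w_1). -/

import Mathlib

open MvPolynomial

/-- The algebra automorphism `σ` of `k[V_m] = k[x_1,…,x_m]` given by
`σ x_i = x_i + x_{i+1}` for `i < m` and `σ x_m = x_m` (0-indexed). -/
noncomputable def sigmaHom (k : Type*) [CommRing k] (m : ℕ) :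
    MvPolynomial (Fin m) k →ₐ[k] MvPolynomial (Fin m) k :=
  aeval (fun i : Fin m =>
    X i + if h : (i : ℕ) + 1 < m then X (⟨(i : ℕ) + 1, h⟩ : Fin m) else 0)

/-- The twisted derivation `Δ = σ - 1` as a `k`-linear endomorphism of `k[V_m]`. -/
noncomputable def delta (k : Type*) [CommRing k] (m : ℕ) :
    Module.End k (MvPolynomial (Fin m) k) :=
  (sigmaHom k m).toLinearMap - LinearMap.id

/-- Identifying `k[V_m] ⊗ V_n` with `Fin n → k[V_m]` via the basis
`w_1, …, w_n` (0-indexed, `σ w_j = Σ_{i ≤ j} (-1)^{j-i} w_i`), this is the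
diagonal action of `σ`:  `(σ·φ) i = Σ_{j ≥ i} (-1)^{j-i} σ(φ j)`.
Covariants are its fixed points. -/
noncomputable def actL (k : Type*) [Field k] (m n : ℕ) :
    (Fin n → MvPolynomial (Fin m) k) →ₗ[k] (Fin n → MvPolynomial (Fin m) k) :=
  LinearMap.pi fun i =>
    ∑ j : Fin n,
      if (i : ℕ) ≤ (j : ℕ) then
        ((-1 : k) ^ ((j : ℕ) - (i : ℕ))) •
          ((sigmaHom k m).toLinearMap ∘ₗ LinearMap.proj j)
      else 0

theorem delta_apply {k : Type*} [CommRing k] {m : ℕ} (f : MvPolynomial (Fin m) k) :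
    delta k m f = sigmaHom k m f - f := rfl

theorem delta_mul {k : Type*} [CommRing k] {m : ℕ} (f g : MvPolynomial (Fin m) k) :
    delta k m (f * g) = delta k m f * g + sigmaHom k m f * delta k m g := by
  simp only [delta_apply, map_mul]
  ring

theorem delta_C {k : Type*} [CommRing k] {m : ℕ} (a : k) : delta k m (C a) = 0 := by
  simp [delta_apply, sigmaHom]

theorem delta_X_zero {k : Type*} [CommRing k] : delta k 2 (X 0) = X 1 := by
  simp [delta_apply, sigmaHom]

theorem delta_X_one {k : Type*} [CommRing k] : delta k 2 (X 1) = 0 := by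
  simp [delta_apply, sigmaHom]

theorem delta_mul_of_invariant {k : Type*} [CommRing k] {m : ℕ} {c : MvPolynomial (Fin m) k}
    (hc : delta k m c = 0) (f : MvPolynomial (Fin m) k) :
    delta k m (c * f) = c * delta k m f := by
  have h : sigmaHom k m c = c := by rwa [delta_apply, sub_eq_zero] at hc
  rw [delta_mul, hc, h, zero_mul, zero_add]

theorem delta_pow_mul_of_invariant {k : Type*} [CommRing k] {m : ℕ}
    {c : MvPolynomial (Fin m) k} (hc : delta k m c = 0) (f : MvPolynomial (Fin m) k) (i : ℕ) :
    (delta k m ^ i) (c * f) = c * (delta k m ^ i) f := by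
  induction i with
  | zero => simp
  | succ i ih =>
    rw [pow_succ', Module.End.mul_apply, ih, delta_mul_of_invariant hc, Module.End.mul_apply]

theorem delta_X_one_pow {k : Type*} [CommRing k] (n : ℕ) :
    delta k 2 (X 1 ^ n) = 0 := by
  simp [delta_apply, sigmaHom]

theorem X_one_dvd_delta {k : Type*} [CommRing k] (f : MvPolynomial (Fin 2) k) :
    X 1 ∣ delta k 2 f := by
  induction f using MvPolynomial.induction_on with
  | C a => simp [delta_C]
  | add f g hf hg => rw [map_add]; exact dvd_add hf hg
  | mul_X f i hf =>
    rw [delta_mul]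
    refine dvd_add (hf.mul_right _) (Dvd.dvd.mul_left ?_ _)
    fin_cases i
    · exact delta_X_zero.symm.dvd
    · exact (dvd_zero _).trans delta_X_one.symm.dvd

theorem X_one_pow_dvd_delta_pow {k : Type*} [CommRing k] (n : ℕ)
    (f : MvPolynomial (Fin 2) k) : X 1 ^ n ∣ (delta k 2 ^ n) f := by
  induction n generalizing f with
  | zero => simp
  | succ n ih =>
    obtain ⟨h, hh⟩ := X_one_dvd_delta f
    rw [pow_succ (delta k 2), Module.End.mul_apply, hh, delta_pow_mul_of_invariant delta_X_one,
      pow_succ']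
    exact mul_dvd_mul_left _ (ih h)

theorem delta_pow_succ_X_zero_mul {k : Type*} [CommRing k] (m : ℕ)
    (f : MvPolynomial (Fin 2) k) :
    (delta k 2 ^ (m + 1)) (X 0 * f) =
      (X 0 + ((m : MvPolynomial (Fin 2) k) + 1) * X 1) * (delta k 2 ^ (m + 1)) f +
        ((m : MvPolynomial (Fin 2) k) + 1) * X 1 * (delta k 2 ^ m) f := by
  have hσ : sigmaHom k 2 (X 0) = X 0 + X 1 := by simp [sigmaHom]
  have step (g : MvPolynomial (Fin 2) k) :
      delta k 2 (X 0 * g) = (X 0 + X 1) * delta k 2 g + X 1 * g := by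
    rw [delta_mul, delta_X_zero, hσ]
    ring
  induction m with
  | zero => simp [step]
  | succ m ih =>
    have hc : delta k 2 (((m : MvPolynomial (Fin 2) k) + 1) * X 1) = 0 := by
      have : ((m : MvPolynomial (Fin 2) k) + 1) * X 1 = C ((m : k) + 1) * X 1 := by simp
      rw [this, delta_mul_of_invariant (delta_C _), delta_X_one, mul_zero]
    rw [pow_succ' _ (m + 1), Module.End.mul_apply, ih, add_mul, map_add, map_add, step,
      delta_mul_of_invariant hc, delta_mul_of_invariant hc, Module.End.mul_apply,
      pow_succ' _ m, Module.End.mul_apply]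
    push_cast
    ring

theorem delta_pow_X_zero_pow {k : Type*} [CommRing k] (j : ℕ) :
    (delta k 2 ^ j) (X 0 ^ j) = (j.factorial : MvPolynomial (Fin 2) k) * X 1 ^ j ∧
      (delta k 2 ^ (j + 1)) (X 0 ^ j) = 0 := by
  induction j with
  | zero => simpa using delta_C (m := 2) (1 : k)
  | succ j ih =>
    have h2 : (delta k 2 ^ (j + 1 + 1)) (X 0 ^ j) = 0 := by
      rw [pow_succ', Module.End.mul_apply, ih.2, map_zero]
    rw [pow_succ' (X 0), delta_pow_succ_X_zero_mul, delta_pow_succ_X_zero_mul, h2, ih.1, ih.2,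
      Nat.factorial_succ]
    push_cast
    constructor <;> ring

theorem delta_pow_X_zero_pow_of_lt {k : Type*} [CommRing k] {i j : ℕ} (h : j < i) :
    (delta k 2 ^ i) (X 0 ^ j : MvPolynomial (Fin 2) k) = 0 := by
  rw [← Nat.sub_add_cancel (Nat.succ_le_of_lt h), pow_add, Module.End.mul_apply,
    (delta_pow_X_zero_pow j).2, map_zero]

theorem natCast_factorial_ne_zero {p : ℕ} (hp : p.Prime) (k : Type*) [Field k] [CharP k p]
    {n : ℕ} (h : n < p) : (n.factorial : k) ≠ 0 := by
  rw [Ne, CharP.cast_eq_zero_iff k p, hp.dvd_factorial]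
  exact h.not_ge

/-- An element killed by `Δ ^ n` is a combination of `1, x, …, x ^ (n - 1)` with invariant
coefficients, when `n ≤ p`. -/
theorem exists_eq_sum_of_delta_pow_eq_zero {p : ℕ} (hp : p.Prime) {k : Type*} [Field k]
    [CharP k p] {n : ℕ} (hn : n ≤ p) (f : MvPolynomial (Fin 2) k) (hf : (delta k 2 ^ n) f = 0) :
    ∃ c : ℕ → MvPolynomial (Fin 2) k, (∀ j, delta k 2 (c j) = 0) ∧
      f = ∑ j ∈ Finset.range n, c j * X 0 ^ j := by
  induction n generalizing f with
  | zero => exact ⟨0, by simp, by simpa using hf⟩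
  | succ n ih =>
    obtain ⟨h, hh⟩ := X_one_pow_dvd_delta_pow n f
    have hinv : delta k 2 h = 0 := by
      rw [pow_succ', Module.End.mul_apply, hh, delta_mul_of_invariant (delta_X_one_pow n)] at hf
      exact (mul_eq_zero.mp hf).resolve_left (pow_ne_zero _ (X_ne_zero _))
    have hfac := natCast_factorial_ne_zero hp k (Nat.lt_of_succ_le hn)
    set a : MvPolynomial (Fin 2) k := C (n.factorial : k)⁻¹ * h with ha
    have hainv : delta k 2 a = 0 := by
      rw [ha, delta_mul_of_invariant (delta_C _), hinv, mul_zero]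
    have key : (delta k 2 ^ n) (f - a * X 0 ^ n) = 0 := by
      have hC : C (n.factorial : k)⁻¹ * (n.factorial : MvPolynomial (Fin 2) k) = 1 := by
        rw [← map_natCast (C : k →+* MvPolynomial (Fin 2) k), ← C_mul, inv_mul_cancel₀ hfac, C_1]
      rw [map_sub, delta_pow_mul_of_invariant hainv, (delta_pow_X_zero_pow n).1, hh, ha]
      linear_combination -(h * X 1 ^ n) * hC
    obtain ⟨c, hc, hfc⟩ := ih (Nat.le_of_succ_le hn) _ key
    refine ⟨Function.update c n a, fun j => ?_, ?_⟩
    · by_cases hj : j = n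
      · subst hj; simpa using hainv
      · simpa [hj] using hc j
    · rw [Finset.sum_range_succ, Function.update_self,
        Finset.sum_congr rfl (g := fun j => c j * X 0 ^ j), ← hfc, sub_add_cancel]
      intro j hj
      rw [Function.update_of_ne (Finset.mem_range.mp hj).ne]

/-- The powers `1, x, …, x ^ (n - 1)` are linearly independent over the invariants,
when `n ≤ p`. -/
theorem eq_zero_of_sum_mul_X_zero_pow_eq_zero {p : ℕ} (hp : p.Prime) {k : Type*} [Field k]
    [CharP k p] {n : ℕ} (hn : n ≤ p) (c : ℕ → MvPolynomial (Fin 2) k)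
    (hc : ∀ j < n, delta k 2 (c j) = 0)
    (h : ∑ j ∈ Finset.range n, c j * X 0 ^ j = 0) : ∀ j < n, c j = 0 := by
  induction n with
  | zero => simp
  | succ n ih =>
    have hcn : c n = 0 := by
      have h' := congrArg (delta k 2 ^ n) h
      rw [Finset.sum_range_succ, map_add, map_sum, Finset.sum_eq_zero, zero_add, map_zero,
        delta_pow_mul_of_invariant (hc n n.lt_succ_self), (delta_pow_X_zero_pow n).1] at h'
      · refine (mul_eq_zero.mp h').resolve_right (mul_ne_zero ?_ (pow_ne_zero _ (X_ne_zero _)))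
        rw [← map_natCast (C : k →+* MvPolynomial (Fin 2) k), Ne, C_eq_zero]
        exact natCast_factorial_ne_zero hp k (Nat.lt_of_succ_le hn)
      · intro j hj
        have hj := Finset.mem_range.mp hj
        rw [delta_pow_mul_of_invariant (hc j (hj.trans n.lt_succ_self)),
          delta_pow_X_zero_pow_of_lt hj, mul_zero]
    rw [Finset.sum_range_succ, hcn, zero_mul, add_zero] at h
    intro j hj
    rcases Nat.lt_succ_iff_lt_or_eq.mp hj with hj | rfl
    · exact ih (Nat.le_of_succ_le hn) (fun i hi => hc i (hi.trans n.lt_succ_self)) h j hj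
    · exact hcn

theorem actL_apply {k : Type*} [Field k] {m n : ℕ} (φ : Fin n → MvPolynomial (Fin m) k)
    (i : Fin n) :
    actL k m n φ i = ∑ j : Fin n,
      if i ≤ j then (-1 : k) ^ ((j : ℕ) - (i : ℕ)) • sigmaHom k m (φ j) else 0 := by
  simp only [actL, LinearMap.pi_apply, LinearMap.sum_apply, Fin.le_def]
  refine Finset.sum_congr rfl fun j _ => ?_
  split_ifs <;> rfl

/-- The components of a covariant satisfy `Δ (φ i) = φ (i + 1)`, with `φ n = 0`. -/
theorem delta_eq_of_actL_eq {k : Type*} [Field k] {m n : ℕ}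
    {φ : Fin n → MvPolynomial (Fin m) k} (hφ : actL k m n φ = φ) (i : Fin n) :
    delta k m (φ i) = if h : (i : ℕ) + 1 < n then φ ⟨i + 1, h⟩ else 0 := by
  have hi := congrFun hφ i
  rw [actL_apply] at hi
  have hnext : (if h : (i : ℕ) + 1 < n then φ ⟨i + 1, h⟩ else 0) = ∑ j : Fin n,
      if i < j then (-1 : k) ^ ((j : ℕ) - (i + 1)) • sigmaHom k m (φ j) else 0 := by
    split_ifs with h
    · rw [← congrFun hφ ⟨i + 1, h⟩, actL_apply]
      rfl
    · refine (Finset.sum_eq_zero fun j _ => if_neg fun hj => h ?_).symm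
      exact lt_of_le_of_lt (Nat.succ_le_of_lt hj) j.isLt
  have hself : sigmaHom k m (φ i) =
      ∑ j : Fin n, if j = i then sigmaHom k m (φ j) else 0 := by simp
  rw [delta_apply, hnext, sub_eq_iff_eq_add]
  conv_rhs => rw [← hi]
  rw [hself, ← Finset.sum_add_distrib]
  refine Finset.sum_congr rfl fun j _ => ?_
  rcases lt_trichotomy i j with h | rfl | h
  · have : (j : ℕ) - i = (j - (i + 1)) + 1 := by have := Fin.lt_def.mp h; omega
    simp [h, h.le, h.ne', this, pow_succ]
  · simp
  · simp [h.not_ge, h.ne, h.not_gt]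

/-- A covariant is determined by its first component: `φ i = Δ ^ i (φ 0)`. -/
theorem eq_delta_pow_of_actL_eq {k : Type*} [Field k] {m n : ℕ} (hn : 0 < n)
    {φ : Fin n → MvPolynomial (Fin m) k} (hφ : actL k m n φ = φ) (i : ℕ) :
    (delta k m ^ i) (φ ⟨0, hn⟩) = if h : i < n then φ ⟨i, h⟩ else 0 := by
  induction i with
  | zero => simp [hn]
  | succ i ih =>
    rw [pow_succ', Module.End.mul_apply, ih]
    split_ifs with h h' h'
    · rw [delta_eq_of_actL_eq hφ, dif_pos h']
    · rw [delta_eq_of_actL_eq hφ, dif_neg h']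
    · omega
    · exact map_zero _

/-- For `1 ≤ n ≤ p`, the module of covariants `k[V_2]^G(V_n)` is free over the
invariant ring `k[V_2]^G = ker Δ`, freely generated by the `n` covariants
`Θ(x_1^j) = Σ_i Δ^{i-1}(x_1^j) ⊗ w_i`, `j = 0, …, n−1`:  every covariant `φ`
is `φ i = Σ_j c_j · Δ^{i-1}(x_1^j)` for unique invariants `c_0, …, c_{n-1}`. -/
theorem statement13 (p : ℕ) (hp : p.Prime) (k : Type*) [Field k] [CharP k p]
    (n : ℕ) (hn : 1 ≤ n) (hnp : n ≤ p)
    (φ : Fin n → MvPolynomial (Fin 2) k) (hφ : actL k 2 n φ = φ) :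
    ∃! c : Fin n → MvPolynomial (Fin 2) k,
      (∀ j : Fin n, delta k 2 (c j) = 0) ∧
      φ = fun i : Fin n =>
        ∑ j : Fin n, c j * (delta k 2 ^ (i : ℕ)) (X 0 ^ (j : ℕ)) := by
  have hsum (c : ℕ → MvPolynomial (Fin 2) k) :
      ∑ j ∈ Finset.range n, c j * X 0 ^ j = ∑ j : Fin n, c j * X 0 ^ (j : ℕ) :=
    Finset.sum_range _
  obtain ⟨c, hc, hfc⟩ := exists_eq_sum_of_delta_pow_eq_zero hp hnp (φ ⟨0, hn⟩)
    ((eq_delta_pow_of_actL_eq hn hφ n).trans (dif_neg (lt_irrefl n)))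
  rw [hsum] at hfc
  refine ⟨fun j => c j, ⟨fun j => hc j, funext fun i => ?_⟩, fun d ⟨hd, hφd⟩ => ?_⟩
  · rw [← (eq_delta_pow_of_actL_eq hn hφ i).trans (dif_pos i.isLt), hfc, map_sum]
    exact Finset.sum_congr rfl fun j _ => delta_pow_mul_of_invariant (hc j) _ _
  · have hfd := congrFun hφd ⟨0, hn⟩
    simp only [pow_zero, Module.End.one_apply] at hfd
    set e : ℕ → MvPolynomial (Fin 2) k := fun j => if h : j < n then d ⟨j, h⟩ - c j else 0 with he
    have hed (j : Fin n) : e j = d j - c j := dif_pos j.isLt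
    have hzero : ∀ j < n, e j = 0 := by
      refine eq_zero_of_sum_mul_X_zero_pow_eq_zero hp hnp e (fun j hj => ?_) ?_
      · rw [hed ⟨j, hj⟩, map_sub, hd, hc, sub_zero]
      · simp only [hsum, hed, sub_mul, Finset.sum_sub_distrib]
        rw [← hfd, ← hfc, sub_self]
    funext j
    exact sub_eq_zero.mp ((hed j).symm.trans (hzero j j.isLt))
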